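/- arXiv:2301.10743 — 2 statements merged into one kernel-verified Lean document; each statement's English description precedes it below -/
import Mathlib

section
/- For any simplified stateless k-counter machine M = (Σ, u, F), there is a sentence of FOC[+;MOD] over Σ that defines exactly the language recognized by M. -/
namespace FOC

/-- Count terms: affine combinations `c₀ + c₁·x₁ + ⋯ + cₖ·xₖ` with rational
coefficients over count variables (named by naturals). -/
structure CTerm where
  const : ℚ
  coeffs : List (ℚ × ℕ)

/-- Evaluate a count term under a count-variable assignment. -/
def CTerm.eval (t : CTerm) (ν : ℕ → ℚ) : ℚ :=
  t.const + (t.coeffs.map fun c => c.1 * ν c.2).sum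

/-- The count variables occurring in a count term. -/
def CTerm.vars (t : CTerm) : Finset ℕ :=
  (t.coeffs.map Prod.snd).toFinset

/-- The count term consisting of a single variable. -/
def CTerm.var (x : ℕ) : CTerm := ⟨0, [(1, x)]⟩

/-- A constant count term. -/
def CTerm.cst (c : ℚ) : CTerm := ⟨c, []⟩

/-- Formulas of FOC[+;MOD] over the alphabet `A`.  Position variables and
count variables are both named by naturals (the two sorts are separate). -/
inductive Formula (A : Type) : Type
  | tru : Formula A
  | fls : Formula A
  | qa (a : A) (p : ℕ) : Formula A
  | mod (r m : ℕ) (p : ℕ) : Formula A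
  | eq (t₁ t₂ : CTerm) : Formula A
  | lt (t₁ t₂ : CTerm) : Formula A
  | and (φ ψ : Formula A) : Formula A
  | or (φ ψ : Formula A) : Formula A
  | not (φ : Formula A) : Formula A
  | exC (x : ℕ) (φ : Formula A) : Formula A
  | allC (x : ℕ) (φ : Formula A) : Formula A
  | cnt (x : ℕ) (p : ℕ) (φ : Formula A) : Formula A

variable {A : Type}

open Classical in
/-- Satisfaction of a formula in a string `w` (positions are `1,…,w.length`;
the letter at position `p` is `w[p-1]`), under a position assignment `ρ` and a
count assignment `ν`.  The counting quantifier `cnt x p φ` holds iff the number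
of positions `j ∈ [1, w.length]` satisfying `φ` equals `ν x`. -/
def Sat (w : List A) : (ℕ → ℕ) → (ℕ → ℚ) → Formula A → Prop
  | _, _, .tru => True
  | _, _, .fls => False
  | ρ, _, .qa a p => w[ρ p - 1]? = some a
  | ρ, _, .mod r m p => ρ p % m = r % m
  | _, ν, .eq t₁ t₂ => t₁.eval ν = t₂.eval ν
  | _, ν, .lt t₁ t₂ => t₁.eval ν < t₂.eval ν
  | ρ, ν, .and φ ψ => Sat w ρ ν φ ∧ Sat w ρ ν ψ
  | ρ, ν, .or φ ψ => Sat w ρ ν φ ∨ Sat w ρ ν ψ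
  | ρ, ν, .not φ => ¬ Sat w ρ ν φ
  | ρ, ν, .exC x φ => ∃ q : ℚ, Sat w ρ (Function.update ν x q) φ
  | ρ, ν, .allC x φ => ∀ q : ℚ, Sat w ρ (Function.update ν x q) φ
  | ρ, ν, .cnt x p φ =>
      (((Finset.Icc 1 w.length).filter
          (fun j => Sat w (Function.update ρ p j) ν φ)).card : ℚ) = ν x

/-- Free position variables of a formula. -/
def freePos : Formula A → Finset ℕ
  | .tru => ∅
  | .fls => ∅
  | .qa _ p => {p}
  | .mod _ _ p => {p}
  | .eq _ _ => ∅
  | .lt _ _ => ∅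
  | .and φ ψ => freePos φ ∪ freePos ψ
  | .or φ ψ => freePos φ ∪ freePos ψ
  | .not φ => freePos φ
  | .exC _ φ => freePos φ
  | .allC _ φ => freePos φ
  | .cnt _ p φ => freePos φ \ {p}

/-- Free count variables of a formula. -/
def freeCount : Formula A → Finset ℕ
  | .tru => ∅
  | .fls => ∅
  | .qa _ _ => ∅
  | .mod _ _ _ => ∅
  | .eq t₁ t₂ => t₁.vars ∪ t₂.vars
  | .lt t₁ t₂ => t₁.vars ∪ t₂.vars
  | .and φ ψ => freeCount φ ∪ freeCount ψ
  | .or φ ψ => freeCount φ ∪ freeCount ψ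
  | .not φ => freeCount φ
  | .exC x φ => freeCount φ \ {x}
  | .allC x φ => freeCount φ \ {x}
  | .cnt x _ φ => freeCount φ ∪ {x}

/-- Quantifier-free formulas (no `∃x`, `∀x`, and no counting quantifier). -/
def QFree : Formula A → Prop
  | .and φ ψ => QFree φ ∧ QFree ψ
  | .or φ ψ => QFree φ ∧ QFree ψ
  | .not φ => QFree φ
  | .exC _ _ => False
  | .allC _ _ => False
  | .cnt _ _ _ => False
  | _ => True

/-- Two formulas are equivalent if they have the same truth value in every
string under every assignment of the (position and count) variables. -/
def FOCEquiv (φ ψ : Formula A) : Prop :=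
  ∀ (w : List A) (ρ : ℕ → ℕ) (ν : ℕ → ℚ), Sat w ρ ν φ ↔ Sat w ρ ν ψ

/-- A sentence is a formula without free variables. -/
def IsSentence (φ : Formula A) : Prop := freePos φ = ∅ ∧ freeCount φ = ∅

/-- The language defined by a sentence. -/
def Defines (σ : Formula A) (L : Set (List A)) : Prop :=
  ∀ w, w ∈ L ↔ Sat w (fun _ => 1) (fun _ => 0) σ

/-- Finite conjunction. -/
def bigAnd (l : List (Formula A)) : Formula A := l.foldr .and .tru

/-- Finite disjunction. -/
def bigOr (l : List (Formula A)) : Formula A := l.foldr .or .fls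

/-- Iterated existential count quantification `∃x₁.…∃xₖ. φ`. -/
def exCs (xs : List ℕ) (φ : Formula A) : Formula A := xs.foldr .exC φ

end FOC

/-- A simplified stateless `k`-counter machine: an alphabet `A`, a counter
update function `u`, and an acceptance mask `F`. -/
structure SSCM (A : Type) where
  k : ℕ
  u : A → Fin k → ℤ
  F : Fin k → Bool

/-- `M` accepts `w` iff, with final counter value `c = Σᵢ u(wᵢ)`, each
coordinate satisfies `cᵢ = 0` exactly when `Fᵢ = 0` (false). -/
def SSCM.accepts {A : Type} (M : SSCM A) (w : List A) : Prop :=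
  ∀ i : Fin M.k, ((w.map M.u).sum i = 0 ↔ M.F i = false)

namespace FOC

variable {A : Type}

theorem sat_exCs {w : List A} {ρ : ℕ → ℕ} {φ : Formula A} (xs : List ℕ) (ν : ℕ → ℚ) :
    Sat w ρ ν (exCs xs φ) ↔ ∃ ν', (∀ x ∉ xs, ν' x = ν x) ∧ Sat w ρ ν' φ := by
  induction xs generalizing ν with
  | nil =>
    constructor
    · exact fun h => ⟨ν, fun _ _ => rfl, h⟩
    · rintro ⟨ν', hν', h⟩
      obtain rfl : ν' = ν := funext fun x => hν' x (by simp)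
      exact h
  | cons y ys ih =>
    change (∃ q, Sat w ρ (Function.update ν y q) (exCs ys φ)) ↔ _
    simp only [ih]
    constructor
    · rintro ⟨q, ν', hν', h⟩
      refine ⟨ν', fun x hx => ?_, h⟩
      rw [List.mem_cons, not_or] at hx
      rw [hν' x hx.2, Function.update_of_ne hx.1]
    · rintro ⟨ν', hν', h⟩
      refine ⟨ν' y, ν', fun x hx => ?_, h⟩
      by_cases hxy : x = y
      · subst hxy
        simp
      · rw [Function.update_of_ne hxy, hν' x (by simp [hxy, hx])]

theorem sat_bigAnd {w : List A} {ρ : ℕ → ℕ} {ν : ℕ → ℚ} (l : List (Formula A)) :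
    Sat w ρ ν (bigAnd l) ↔ ∀ φ ∈ l, Sat w ρ ν φ := by
  induction l with
  | nil => simp [bigAnd, Sat]
  | cons φ l ih =>
    rw [List.forall_mem_cons, ← ih]
    rfl

theorem freePos_exCs (xs : List ℕ) (φ : Formula A) : freePos (exCs xs φ) = freePos φ := by
  induction xs with
  | nil => rfl
  | cons x xs ih => exact ih

theorem freeCount_exCs (xs : List ℕ) (φ : Formula A) :
    freeCount (exCs xs φ) = freeCount φ \ xs.toFinset := by
  induction xs with
  | nil => simp [exCs]
  | cons x xs ih =>
    change freeCount (exCs xs φ) \ {x} = _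
    rw [ih]
    ext y
    simp only [Finset.mem_sdiff, List.mem_toFinset, Finset.mem_singleton, List.mem_cons]
    tauto

theorem freePos_bigAnd_subset {l : List (Formula A)} {s : Finset ℕ}
    (h : ∀ φ ∈ l, freePos φ ⊆ s) : freePos (bigAnd l) ⊆ s := by
  induction l with
  | nil => exact Finset.empty_subset s
  | cons φ l ih =>
    rw [List.forall_mem_cons] at h
    exact Finset.union_subset h.1 (ih h.2)

theorem freeCount_bigAnd_subset {l : List (Formula A)} {s : Finset ℕ}
    (h : ∀ φ ∈ l, freeCount φ ⊆ s) : freeCount (bigAnd l) ⊆ s := by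
  induction l with
  | nil => exact Finset.empty_subset s
  | cons φ l ih =>
    rw [List.forall_mem_cons] at h
    exact Finset.union_subset h.1 (ih h.2)

open Classical in
theorem card_filter_getElem?_eq_count (w : List A) (a : A) :
    ((Finset.range w.length).filter (fun j => w[j]? = some a)).card = w.count a := by
  induction w using List.reverseRecOn with
  | nil => simp
  | append_singleton w b ih =>
    have hcongr : (Finset.range w.length).filter (fun j => (w ++ [b])[j]? = some a) =
        (Finset.range w.length).filter (fun j => w[j]? = some a) := by
      refine Finset.filter_congr fun j hj => ?_
      rw [List.getElem?_append_left (Finset.mem_range.mp hj)]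
    rw [List.length_append, List.length_singleton, Finset.range_add_one, Finset.filter_insert,
      hcongr, List.count_append, ← ih]
    by_cases hb : b = a
    · simp [hb]
    · simp [hb]

open Classical in
theorem sat_cnt_qa {w : List A} {ρ : ℕ → ℕ} {ν : ℕ → ℚ} (x p : ℕ) (a : A) :
    Sat w ρ ν (.cnt x p (.qa a p)) ↔ (w.count a : ℚ) = ν x := by
  simp only [Sat, Function.update_self]
  rw [← card_filter_getElem?_eq_count w a]
  have himage : (Finset.Icc 1 w.length).filter (fun j => w[j - 1]? = some a) =
      ((Finset.range w.length).filter (fun j => w[j]? = some a)).image (· + 1) := by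
    ext j
    simp only [Finset.mem_filter, Finset.mem_Icc, Finset.mem_image, Finset.mem_range]
    constructor
    · rintro ⟨⟨h1, h2⟩, h⟩
      exact ⟨j - 1, ⟨by omega, h⟩, by omega⟩
    · rintro ⟨i, ⟨hi, h⟩, rfl⟩
      exact ⟨⟨by omega, by omega⟩, h⟩
  rw [himage, Finset.card_image_of_injective _ (add_left_injective 1)]

end FOC

namespace SSCM

open FOC

variable {A : Type}

open Classical in
theorem counter_eq_sum_count [Fintype A] (M : SSCM A) (w : List A) (i : Fin M.k) :
    (w.map M.u).sum i = ∑ a, (M.u a i) * (w.count a : ℤ) := by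
  induction w with
  | nil => simp
  | cons b w ih =>
    simp [ih, List.count_cons, mul_add, Finset.sum_add_distrib, add_comm]

/-- The value of counter `i`, where count variable `f a` holds the number of letters `a`. -/
noncomputable def counterTerm [Fintype A] (M : SSCM A) (f : A → ℕ) (i : Fin M.k) : CTerm :=
  ⟨0, Finset.univ.toList.map fun a => ((M.u a i : ℚ), f a)⟩

/-- The acceptance condition on counter `i`, where count variable `f a` holds the number of
letters `a`. -/
noncomputable def counterTest [Fintype A] (M : SSCM A) (f : A → ℕ) (i : Fin M.k) : Formula A :=
  if M.F i then .not (.eq (M.counterTerm f i) (.cst 0)) else .eq (M.counterTerm f i) (.cst 0)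

/-- Quantifier matrix of `acceptFormula`. -/
noncomputable def acceptMatrix [Fintype A] (M : SSCM A) (f : A → ℕ) : Formula A :=
  .and (bigAnd (Finset.univ.toList.map fun a => .cnt (f a) 0 (.qa a 0)))
    (bigAnd ((List.finRange M.k).map (M.counterTest f)))

/-- A sentence stating that `M` accepts, where the count variable `f a` is used for the number of
letters `a`. -/
noncomputable def acceptFormula [Fintype A] (M : SSCM A) (f : A → ℕ) : Formula A :=
  exCs (Finset.univ.toList.map f) (M.acceptMatrix f)

theorem freePos_counterTest [Fintype A] (M : SSCM A) (f : A → ℕ) (i : Fin M.k) :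
    freePos (M.counterTest f i) = ∅ := by
  unfold counterTest
  split_ifs <;> rfl

theorem freeCount_counterTest [Fintype A] (M : SSCM A) (f : A → ℕ) (i : Fin M.k) :
    freeCount (M.counterTest f i) = (Finset.univ.toList.map f).toFinset := by
  have h : (M.counterTerm f i).vars ∪ (CTerm.cst 0).vars = (Finset.univ.toList.map f).toFinset := by
    simp [CTerm.vars, counterTerm, CTerm.cst, Function.comp_def]
  unfold counterTest
  split_ifs <;> exact h

theorem isSentence_acceptFormula [Fintype A] (M : SSCM A) (f : A → ℕ) :
    IsSentence (M.acceptFormula f) := by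
  constructor
  · rw [acceptFormula, freePos_exCs, ← Finset.subset_empty]
    refine Finset.union_subset (freePos_bigAnd_subset ?_) (freePos_bigAnd_subset ?_)
    · simp [freePos]
    · simp [freePos_counterTest]
  · rw [acceptFormula, freeCount_exCs, Finset.sdiff_eq_empty_iff_subset]
    refine Finset.union_subset (freeCount_bigAnd_subset ?_) (freeCount_bigAnd_subset ?_)
    · simp [freeCount]
    · simp [freeCount_counterTest]

open Classical in
theorem sat_counterTest [Fintype A] (M : SSCM A) {f : A → ℕ} {w : List A} {ρ : ℕ → ℕ}
    {ν : ℕ → ℚ} (hν : ∀ a, (w.count a : ℚ) = ν (f a)) (i : Fin M.k) :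
    Sat w ρ ν (M.counterTest f i) ↔ ((w.map M.u).sum i = 0 ↔ M.F i = false) := by
  have heval : (M.counterTerm f i).eval ν = (((w.map M.u).sum i : ℤ) : ℚ) := by
    simp [counterTerm, CTerm.eval, counter_eq_sum_count, Function.comp_def, hν,
      Finset.sum_map_toList]
  have hcst : (CTerm.cst 0).eval ν = 0 := by simp [CTerm.cst, CTerm.eval]
  cases h : M.F i <;> simp [counterTest, h, Sat, heval, hcst]

theorem defines_acceptFormula [Fintype A] (M : SSCM A) {f : A → ℕ} (hf : Function.Injective f) :
    Defines (M.acceptFormula f) {w | M.accepts w} := by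
  classical
  intro w
  have hmatrix : ∀ ρ ν, Sat w ρ ν (M.acceptMatrix f) ↔
      (∀ a, (w.count a : ℚ) = ν (f a)) ∧ M.accepts w := by
    intro ρ ν
    change Sat w ρ ν (bigAnd _) ∧ Sat w ρ ν (bigAnd _) ↔ _
    simp only [sat_bigAnd, List.forall_mem_map, Finset.mem_toList, Finset.mem_univ,
      List.mem_finRange, forall_true_left, sat_cnt_qa]
    exact and_congr_right fun hν => forall_congr' (M.sat_counterTest hν)
  simp only [acceptFormula, sat_exCs, hmatrix, Set.mem_ofPred_eq]
  constructor
  · intro h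
    refine ⟨Function.extend f (fun a => (w.count a : ℚ)) 0, fun x hx => ?_,
      fun a => (hf.extend_apply (fun a => (w.count a : ℚ)) 0 a).symm, h⟩
    exact Function.extend_apply' _ _ _ (by simpa using hx)
  · rintro ⟨-, -, -, h⟩
    exact h

end SSCM

/-- **Proposition 9.** For any simplified stateless `k`-counter machine `M`,
there is a sentence of FOC[+;MOD] defining exactly the language recognized
by `M`. -/
theorem sscm_to_foc {A : Type} [Fintype A] (M : SSCM A) :
    ∃ σ : FOC.Formula A, FOC.IsSentence σ ∧ FOC.Defines σ {w | M.accepts w} := by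
  exact ⟨M.acceptFormula fun a => (Fintype.equivFin A a : ℕ), M.isSentence_acceptFormula _,
    M.defines_acceptFormula (Fin.val_injective.comp (Fintype.equivFin A).injective)⟩
end

section
/- Let F_{r,s} = {i/2^s | −2^{r+s} ≤ i < 2^{r+s}} and, for input length n, let n' = n+1 and E_{r,s,n'} = {i/(2^s n') | −2^{r+s}n' ≤ i < 2^{r+s}n'}. Given a family of functions a : Σ^n → F_{r,s}^{n'} that is defined by FOC[+;MOD] formulas ⟨φ^a_k[p], ω^a_k⟩ (for each k ∈ [−s,r], w ⊨ φ^a_k[p] iff bit k of the two's-complement representation of [a(w)]_p is 1 for positions p ∈ [1,n], and w ⊨ ω^a_k iff bit k of [a(w)]_0 is 1), the average function ā(w) = (1/n') Σ_{p=0}^{n} [a(w)]_p is approximated with error at most 2^{−s} by a function Σ* → E_{r,s,n'} that is definable in FOC[+;MOD] (bitwise, together with a formula giving its extra digit). -/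
namespace FOC

/-- Fixed-precision numbers `F_{r,s} = {i/2^s | −2^{r+s} ≤ i < 2^{r+s}}`, as rationals. -/
def FsetQ (r s : ℕ) : Set ℚ :=
  {q | ∃ i : ℤ, -(2:ℤ)^(r+s) ≤ i ∧ i < 2^(r+s) ∧ q = (i : ℚ) / 2^s}

/-- Extra-precision numbers `E_{r,s,n'} = {i/(2^s n') | −2^{r+s}n' ≤ i < 2^{r+s}n'}`. -/
def EsetQ (r s n' : ℕ) : Set ℚ :=
  {q | ∃ i : ℤ, -((2:ℤ)^(r+s) * n') ≤ i ∧ i < 2^(r+s) * n' ∧ q = (i : ℚ) / (2^s * n')}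

/-- The `k`-th bit of the two's-complement representation:
`bit_k(x) = ⌊x/2^k⌋ − 2⌊x/2^{k+1}⌋`. -/
def bit (k : ℤ) (x : ℚ) : ℤ := ⌊x / (2:ℚ)^k⌋ - 2 * ⌊x / (2:ℚ)^(k+1)⌋

/-- `fixed(a) = ⌊a·2^s⌋·2^{−s}`: the fixed-precision part of an extra-precision number. -/
def fixedPart (s : ℕ) (a : ℚ) : ℚ := (⌊a * 2^s⌋ : ℚ) / 2^s

/-- `extra(a) = ⌊a·2^s·n'⌋ − ⌊a·2^s⌋·n'`: the extra digit of an extra-precision number. -/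
def extraDigit (s n' : ℕ) (a : ℚ) : ℤ := ⌊a * 2^s * n'⌋ - ⌊a * 2^s⌋ * n'

/-- `a : Σ* → F_{r,s}` is defined by the family of sentences `σ k` (for
`k ∈ [−s, r]`) if `w ⊨ σ k` iff bit `k` of `a(w)` is 1. -/
def DefinedBy {A : Type} (r s : ℕ) (a : List A → ℚ) (σ : ℤ → Formula A) : Prop :=
  ∀ k : ℤ, -(s:ℤ) ≤ k → k ≤ r →
    IsSentence (σ k) ∧
    ∀ w, (Sat w (fun _ => 1) (fun _ => 0) (σ k) ↔ bit k (a w) = 1)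

/-- `a : Σ* → E_{r,s,n'}` (with `n' = |w|+1`) is defined by `⟨σ k, φx⟩` if the
sentences `σ k` define `fixed(a(w))` bitwise and `φx`, whose only free variable
is the count variable `xv`, holds of `q` iff `q = extra(a(w))`. -/
def EDefinedBy {A : Type} (r s : ℕ) (a : List A → ℚ) (σ : ℤ → Formula A)
    (xv : ℕ) (φx : Formula A) : Prop :=
  DefinedBy r s (fun w => fixedPart s (a w)) σ ∧
  freePos φx = ∅ ∧ freeCount φx ⊆ {xv} ∧
  ∀ (w : List A) (q : ℚ),
    (Sat w (fun _ => 1) (Function.update (fun _ => 0) xv q) φx ↔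
      q = (extraDigit s (w.length + 1) (a w) : ℚ))

end FOC

namespace FOC

theorem sat_congr {A : Type} (w : List A) (φ : Formula A) :
    ∀ (ρ ρ' : ℕ → ℕ) (ν ν' : ℕ → ℚ), (∀ p ∈ freePos φ, ρ p = ρ' p) →
      (∀ x ∈ freeCount φ, ν x = ν' x) → (Sat w ρ ν φ ↔ Sat w ρ' ν' φ) := by
  have eval_congr : ∀ (t : CTerm) (ν ν' : ℕ → ℚ), (∀ x ∈ t.vars, ν x = ν' x) →
      t.eval ν = t.eval ν' := by
    intro t ν ν' h
    unfold CTerm.eval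
    congr 2
    refine List.map_congr_left fun c hc => ?_
    rw [h c.2 (by simp only [CTerm.vars, List.mem_toFinset]; exact List.mem_map_of_mem hc)]
  have update_congr : ∀ {B : Type} (f g : ℕ → B) (s : Finset ℕ) (x : ℕ) (b : B),
      (∀ y ∈ s \ {x}, f y = g y) →
        ∀ y ∈ s, Function.update f x b y = Function.update g x b y := by
    intro B f g s x b h y hy
    by_cases hyx : y = x
    · simp [hyx]
    · simpa [hyx] using h y (by simp [hy, hyx])
  induction φ with
  | tru | fls => intros; rfl
  | qa a p =>
    intro ρ ρ' ν ν' hρ _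
    simp only [Sat, hρ p (by simp [freePos])]
  | mod r m p =>
    intro ρ ρ' ν ν' hρ _
    simp only [Sat, hρ p (by simp [freePos])]
  | eq t₁ t₂ | lt t₁ t₂ =>
    intro ρ ρ' ν ν' _ hν
    simp only [freeCount, Finset.mem_union] at hν
    simp only [Sat, eval_congr t₁ ν ν' fun x hx => hν x (.inl hx),
      eval_congr t₂ ν ν' fun x hx => hν x (.inr hx)]
  | and φ ψ ihφ ihψ | or φ ψ ihφ ihψ =>
    intro ρ ρ' ν ν' hρ hν
    simp only [freePos, freeCount, Finset.mem_union] at hρ hν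
    simp only [Sat, ihφ ρ ρ' ν ν' (fun p hp => hρ p (.inl hp)) fun x hx => hν x (.inl hx),
      ihψ ρ ρ' ν ν' (fun p hp => hρ p (.inr hp)) fun x hx => hν x (.inr hx)]
  | not φ ih =>
    intro ρ ρ' ν ν' hρ hν
    simp only [Sat, ih ρ ρ' ν ν' hρ hν]
  | exC x φ ih =>
    intro ρ ρ' ν ν' hρ hν
    exact exists_congr fun q => ih _ _ _ _ hρ (update_congr _ _ _ _ _ hν)
  | allC x φ ih =>
    intro ρ ρ' ν ν' hρ hν
    exact forall_congr' fun q => ih _ _ _ _ hρ (update_congr _ _ _ _ _ hν)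
  | cnt x p φ ih =>
    intro ρ ρ' ν ν' hρ hν
    have h : ∀ j, Sat w (Function.update ρ p j) ν φ ↔ Sat w (Function.update ρ' p j) ν' φ :=
      fun j => ih _ _ _ _ (update_congr _ _ _ _ _ hρ) fun y hy => hν y (by simp [freeCount, hy])
    simp only [Sat]
    classical
    rw [Finset.filter_congr fun j _ => h j, hν x (by simp [freeCount])]

/-- A property of strings that is expressed by a sentence. -/
def DefinablePred {A : Type} (P : List A → Prop) : Prop :=
  ∃ φ : Formula A, IsSentence φ ∧ ∀ w ρ ν, Sat w ρ ν φ ↔ P w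

/-- A rational function of strings whose graph is expressed, for every count variable `x`,
by a formula with `x` as its only free variable. -/
def DefinableFun {A : Type} (f : List A → ℚ) : Prop :=
  ∀ x : ℕ, ∃ φ : Formula A, freePos φ = ∅ ∧ freeCount φ ⊆ {x} ∧
    ∀ w ρ ν, Sat w ρ ν φ ↔ ν x = f w

section Closure

variable {A : Type} {P Q : List A → Prop} {f g : List A → ℚ}

theorem DefinablePred.and (hP : DefinablePred P) (hQ : DefinablePred Q) :
    DefinablePred fun w => P w ∧ Q w := by
  obtain ⟨φ, ⟨hp, hc⟩, h⟩ := hP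
  obtain ⟨ψ, ⟨hp', hc'⟩, h'⟩ := hQ
  exact ⟨.and φ ψ, by simp [IsSentence, freePos, freeCount, *], fun w ρ ν => by simp [Sat, h, h']⟩

theorem DefinablePred.or (hP : DefinablePred P) (hQ : DefinablePred Q) :
    DefinablePred fun w => P w ∨ Q w := by
  obtain ⟨φ, ⟨hp, hc⟩, h⟩ := hP
  obtain ⟨ψ, ⟨hp', hc'⟩, h'⟩ := hQ
  exact ⟨.or φ ψ, by simp [IsSentence, freePos, freeCount, *], fun w ρ ν => by simp [Sat, h, h']⟩

theorem DefinablePred.exists_mem {ι : Type*} (s : Finset ι) {R : ι → List A → Prop}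
    (hR : ∀ i ∈ s, DefinablePred (R i)) : DefinablePred fun w => ∃ i ∈ s, R i w := by
  classical
  induction s using Finset.induction_on with
  | empty => exact ⟨.fls, by simp [IsSentence, freePos, freeCount], by simp [Sat]⟩
  | insert i s _ ih =>
    simp only [Finset.exists_mem_insert]
    exact (hR i (by simp)).or (ih fun j hj => hR j (by simp [hj]))

theorem DefinableFun.const (c : ℚ) : DefinableFun fun _ : List A => c := fun x =>
  ⟨.eq (.var x) (.cst c), by simp [freePos],
    by simp [freeCount, CTerm.vars, CTerm.var, CTerm.cst],
    by simp [Sat, CTerm.eval, CTerm.var, CTerm.cst]⟩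

theorem DefinableFun.add (hf : DefinableFun f) (hg : DefinableFun g) :
    DefinableFun fun w => f w + g w := by
  intro x
  obtain ⟨φ, hp, hc, h⟩ := hf (x + 1)
  obtain ⟨ψ, hp', hc', h'⟩ := hg (x + 2)
  refine ⟨.exC (x + 1) (.exC (x + 2)
    (.and (.and φ ψ) (.eq (.var x) ⟨0, [(1, x + 1), (1, x + 2)]⟩))), ?_, ?_, ?_⟩
  · simp [freePos, hp, hp']
  · intro y hy
    simp only [freeCount, CTerm.vars, CTerm.var] at hy
    simp only [Finset.mem_sdiff, Finset.mem_union, Finset.mem_singleton, List.mem_toFinset] at hy ⊢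
    have h₁ := @hc y
    have h₂ := @hc' y
    simp at h₁ h₂ hy
    grind
  · intro w ρ ν
    simp [Sat, h, h', CTerm.eval, CTerm.var, and_assoc]

theorem DefinableFun.const_mul (c : ℚ) (hf : DefinableFun f) :
    DefinableFun fun w => c * f w := by
  intro x
  obtain ⟨φ, hp, hc, h⟩ := hf (x + 1)
  refine ⟨.exC (x + 1) (.and φ (.eq (.var x) ⟨0, [(c, x + 1)]⟩)), ?_, ?_, ?_⟩
  · simp [freePos, hp]
  · intro y hy
    simp only [freeCount, CTerm.vars, CTerm.var] at hy
    have h₁ := @hc y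
    simp at h₁ hy ⊢
    grind
  · intro w ρ ν
    simp [Sat, h, CTerm.eval, CTerm.var]

theorem DefinableFun.sub (hf : DefinableFun f) (hg : DefinableFun g) :
    DefinableFun fun w => f w - g w := by
  simpa [sub_eq_add_neg] using hf.add (hg.const_mul (-1))

theorem DefinableFun.sum {ι : Type*} (s : Finset ι) {F : ι → List A → ℚ}
    (hF : ∀ i ∈ s, DefinableFun (F i)) : DefinableFun fun w => ∑ i ∈ s, F i w := by
  classical
  induction s using Finset.induction_on with
  | empty => simpa using DefinableFun.const (A := A) 0
  | insert i s hi ih =>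
    simp only [Finset.sum_insert hi]
    exact (hF i (by simp)).add (ih fun j hj => hF j (by simp [hj]))

theorem DefinableFun.ite_zero [DecidablePred P] (hP : DefinablePred P) (hf : DefinableFun f) :
    DefinableFun fun w => if P w then f w else 0 := by
  intro x
  obtain ⟨φ, ⟨hp, hc⟩, h⟩ := hP
  obtain ⟨ψ, hp', hc', h'⟩ := hf x
  obtain ⟨χ, hp'', hc'', h''⟩ := DefinableFun.const (A := A) 0 x
  refine ⟨.or (.and φ ψ) (.and (.not φ) χ), ?_, ?_, ?_⟩
  · simp [freePos, *]
  · simp only [freeCount, hc, Finset.empty_union]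
    exact Finset.union_subset hc' hc''
  · intro w ρ ν
    by_cases hw : P w <;> simp [Sat, h, h', h'', hw]

theorem DefinableFun.le (hf : DefinableFun f) (hg : DefinableFun g) :
    DefinablePred fun w => f w ≤ g w := by
  obtain ⟨φ, hp, hc, h⟩ := hf 0
  obtain ⟨ψ, hp', hc', h'⟩ := hg 1
  refine ⟨.exC 0 (.exC 1 (.and (.and φ ψ) (.not (.lt (.var 1) (.var 0))))), ⟨?_, ?_⟩, ?_⟩
  · simp [freePos, hp, hp']
  · ext y
    have h₁ := @hc y
    have h₂ := @hc' y
    simp [freeCount, CTerm.vars, CTerm.var] at h₁ h₂ ⊢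
    grind
  · intro w ρ ν
    simp [Sat, h, h', CTerm.eval, CTerm.var, and_assoc]

theorem DefinableFun.lt (hf : DefinableFun f) (hg : DefinableFun g) :
    DefinablePred fun w => f w < g w := by
  obtain ⟨φ, ⟨hp, hc⟩, h⟩ := hg.le hf
  exact ⟨.not φ, ⟨by simp [freePos, hp], by simp [freeCount, hc]⟩, by simp [Sat, h]⟩

open Classical in
theorem DefinableFun.card_filter {R : (w : List A) → ℕ → Prop} {φ : Formula A} {p : ℕ}
    (hp : freePos φ ⊆ {p}) (hc : freeCount φ = ∅)
    (h : ∀ w j, 1 ≤ j → j ≤ w.length → (Sat w (fun _ => j) (fun _ => 0) φ ↔ R w j)) :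
    DefinableFun fun w => (((Finset.Icc 1 w.length).filter (R w)).card : ℚ) := by
  intro x
  refine ⟨.cnt x p φ, by simpa [freePos] using hp, by simp [freeCount, hc], fun w ρ ν => ?_⟩
  have : (Finset.Icc 1 w.length).filter (fun j => Sat w (Function.update ρ p j) ν φ) =
      (Finset.Icc 1 w.length).filter (R w) := by
    refine Finset.filter_congr fun j hj => ?_
    rw [Finset.mem_Icc] at hj
    rw [← h w j hj.1 hj.2]
    refine sat_congr w φ _ _ _ _ (fun q hq => ?_) (by simp [hc])
    simp [Finset.mem_singleton.1 (hp hq)]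
  simp only [Sat, this, eq_comm]

theorem DefinablePred.of_isSentence {φ : Formula A} (hφ : IsSentence φ)
    (h : ∀ w, Sat w (fun _ => 1) (fun _ => 0) φ ↔ P w) : DefinablePred P :=
  ⟨φ, hφ, fun w ρ ν => by
    rw [← h w]; exact sat_congr w φ _ _ _ _ (by simp [hφ.1]) (by simp [hφ.2])⟩

end Closure

theorem bit_div_two_pow (s j : ℕ) (i : ℤ) :
    bit ((j : ℤ) - s) ((i : ℚ) / 2 ^ s) = i / 2 ^ j - 2 * (i / 2 ^ (j + 1)) := by
  have key : ∀ m : ℕ, ⌊(i : ℚ) / 2 ^ s / (2 : ℚ) ^ ((m : ℤ) - s)⌋ = i / 2 ^ m := by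
    intro m
    have : (i : ℚ) / 2 ^ s / (2 : ℚ) ^ ((m : ℤ) - s) = (i : ℚ) / ((2 ^ m : ℕ) : ℚ) := by
      rw [zpow_sub₀ two_ne_zero, zpow_natCast, zpow_natCast]
      push_cast
      field_simp
    rw [this, Rat.floor_intCast_div_natCast]
    norm_cast
  have h₁ := key (j + 1)
  unfold bit
  rw [key j, ← h₁]
  push_cast
  ring_nf

theorem bit_div_two_pow_eq (s j : ℕ) (i : ℤ) :
    bit ((j : ℤ) - s) ((i : ℚ) / 2 ^ s) =
      if bit ((j : ℤ) - s) ((i : ℚ) / 2 ^ s) = 1 then 1 else 0 := by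
  have : i / 2 ^ (j + 1) = i / 2 ^ j / 2 := by
    rw [pow_succ, Int.ediv_ediv_of_nonneg (by positivity)]
  rw [bit_div_two_pow, this]
  split_ifs <;> omega

/-- The value of a two's-complement numeral in terms of its bits. -/
theorem twos_complement (r s : ℕ) (i : ℤ) (h₁ : -(2 : ℤ) ^ (r + s) ≤ i) (h₂ : i < 2 ^ (r + s)) :
    i = ∑ j ∈ Finset.range (r + s + 1), 2 ^ j * bit ((j : ℤ) - s) ((i : ℚ) / 2 ^ s) -
      2 ^ (r + s + 1) * bit (((r + s : ℕ) : ℤ) - s) ((i : ℚ) / 2 ^ s) := by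
  have telescope : ∀ m : ℕ, ∑ j ∈ Finset.range m, 2 ^ j * bit ((j : ℤ) - s) ((i : ℚ) / 2 ^ s) =
      i - 2 ^ m * (i / 2 ^ m) := by
    intro m
    induction m with
    | zero => simp
    | succ m ih => rw [Finset.sum_range_succ, ih, bit_div_two_pow]; ring
  have hpos : (0 : ℤ) < 2 ^ (r + s) := by positivity
  rw [telescope, bit_div_two_pow]
  have hd : i / 2 ^ (r + s + 1) = i / 2 ^ (r + s) / 2 := by
    rw [pow_succ, Int.ediv_ediv_of_nonneg (by positivity)]
  have hl : -1 ≤ i / 2 ^ (r + s) := by rw [Int.le_ediv_iff_mul_le hpos]; linarith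
  have hu : i / 2 ^ (r + s) < 1 := by rw [Int.ediv_lt_iff_lt_mul hpos]; linarith
  have : i / 2 ^ (r + s) - 2 * (i / 2 ^ (r + s + 1)) = -(i / 2 ^ (r + s + 1)) := by omega
  rw [this]
  ring

/-- An integer quotient of definable functions is definable, given a bound on it. -/
theorem definablePred_ediv_eq {A : Type} {S N : List A → ℤ} (hN : ∀ w, 0 < N w)
    (hS : DefinableFun fun w => (S w : ℚ)) (hN' : DefinableFun fun w => (N w : ℚ)) (d : ℤ) :
    DefinablePred fun w => S w / N w = d := by
  have h := ((hN'.const_mul d).le hS).and (hS.lt (hN'.const_mul (d + 1)))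
  convert h using 2 with w
  norm_cast
  rw [← Int.le_ediv_iff_mul_le (hN w), ← Int.ediv_lt_iff_lt_mul (hN w)]
  omega

/-- A quotient `S / (2 ^ s * (|w| + 1))` with definable numerator is definable. -/
theorem exists_eDefinedBy {A : Type} (r s : ℕ) (S : List A → ℤ)
    (hS : DefinableFun fun w => (S w : ℚ))
    (hl : ∀ w, -(2 : ℤ) ^ (r + s) * (w.length + 1 : ℕ) ≤ S w)
    (hu : ∀ w, S w < 2 ^ (r + s) * (w.length + 1 : ℕ)) :
    ∃ (σ : ℤ → Formula A) (x : ℕ) (φ : Formula A),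
      EDefinedBy r s (fun w => (S w : ℚ) / (2 ^ s * (w.length + 1 : ℕ))) σ x φ := by
  classical
  set N : List A → ℤ := fun w => (w.length + 1 : ℕ) with hNdef
  have hN : ∀ w, 0 < N w := fun w => by positivity
  have hN' : DefinableFun fun w => (N w : ℚ) := by
    have := (DefinableFun.card_filter (A := A) (R := fun _ _ => True) (φ := .tru) (p := 0)
      (by simp [freePos]) rfl (by simp [Sat])).add (.const 1)
    convert this using 2 with w
    simp [hNdef]
  have hD := definablePred_ediv_eq hN hS hN'
  set I : Finset ℤ := Finset.Ico (-(2 : ℤ) ^ (r + s)) (2 ^ (r + s)) with hI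
  have hmem : ∀ w, S w / N w ∈ I := fun w => by
    rw [hI, Finset.mem_Ico, Int.le_ediv_iff_mul_le (hN w), Int.ediv_lt_iff_lt_mul (hN w)]
    exact ⟨hl w, hu w⟩
  have hfloor : ∀ w, ⌊(S w : ℚ) / (2 ^ s * (w.length + 1 : ℕ)) * 2 ^ s⌋ = S w / N w := by
    intro w
    rw [show (S w : ℚ) / (2 ^ s * (w.length + 1 : ℕ)) * 2 ^ s = (S w : ℚ) / (w.length + 1 : ℕ) by
      field_simp, Rat.floor_intCast_div_natCast]
  have hbits : ∀ k : ℤ, DefinablePred fun w : List A =>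
      bit k (((S w / N w : ℤ) : ℚ) / 2 ^ s) = 1 := by
    intro k
    have h := DefinablePred.exists_mem (I.filter fun d : ℤ => bit k ((d : ℚ) / 2 ^ s) = 1)
      (R := fun d w => S w / N w = d) fun d _ => hD d
    convert h using 2 with w
    have := hmem w
    simp [this]
  have hextra : DefinableFun fun w => ((S w - S w / N w * N w : ℤ) : ℚ) := by
    have h := DefinableFun.sum I (F := fun (d : ℤ) w => if S w / N w = d then S w - d * N w else 0)
      fun d _ => (hS.sub (hN'.const_mul d)).ite_zero (hD d)
    convert h using 2 with w
    have := hmem w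
    simp only [Finset.sum_ite_eq, this, if_true]
    push_cast
    rfl
  choose σ hσ hσ' using hbits
  obtain ⟨φ, hp, hc, h⟩ := hextra 0
  refine ⟨σ, 0, φ, fun k _ _ => ⟨hσ k, fun w => ?_⟩, hp, hc, fun w q => ?_⟩
  · simp only [hσ' k w, fixedPart, hfloor]
  · rw [h, extraDigit, hfloor, Function.update_self]
    have : (S w : ℚ) / (2 ^ s * (w.length + 1 : ℕ)) * 2 ^ s * (w.length + 1 : ℕ) = S w := by
      field_simp
    rw [this, Int.floor_intCast]

end FOC

/-- **Proposition (averages are definable).** Given a family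
`a : Σⁿ → F_{r,s}^{n+1}` defined in FOC[+;MOD] by formulas `φ k` (with one
free position variable `pv`, for positions `p ∈ [1,n]`) and sentences `ω k`
(for position 0), the average `ā(w) = (1/(n+1)) Σ_{p=0}^{n} [a(w)]_p` is
approximated with error at most `2^{−s}` by a function `Σ* → E_{r,s,n+1}`
that is definable in FOC[+;MOD] (bitwise, with a formula for its extra
digit). -/
theorem average_definable {A : Type} [Fintype A] (r s : ℕ)
    (a : (w : List A) → Fin (w.length + 1) → ℚ)
    (ha : ∀ w p, a w p ∈ FOC.FsetQ r s)
    (pv : ℕ) (φ ω : ℤ → FOC.Formula A)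
    (hfree : ∀ k : ℤ, -(s:ℤ) ≤ k → k ≤ r →
      FOC.freeCount (φ k) = ∅ ∧ FOC.freePos (φ k) ⊆ {pv} ∧ FOC.IsSentence (ω k))
    (hφ : ∀ k : ℤ, -(s:ℤ) ≤ k → k ≤ r → ∀ (w : List A) (p : ℕ)
      (hp1 : 1 ≤ p) (hp2 : p ≤ w.length),
      (FOC.Sat w (fun _ => p) (fun _ => 0) (φ k) ↔
        FOC.bit k (a w ⟨p, by omega⟩) = 1))
    (hω : ∀ k : ℤ, -(s:ℤ) ≤ k → k ≤ r → ∀ w : List A,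
      (FOC.Sat w (fun _ => 1) (fun _ => 0) (ω k) ↔
        FOC.bit k (a w ⟨0, Nat.succ_pos _⟩) = 1)) :
    ∃ abar : List A → ℚ,
      (∀ w, abar w ∈ FOC.EsetQ r s (w.length + 1)) ∧
      (∀ w, |abar w - (∑ p, a w p) / (w.length + 1)| ≤ (1:ℚ) / 2 ^ s) ∧
      ∃ (σ : ℤ → FOC.Formula A) (xv : ℕ) (φx : FOC.Formula A),
        FOC.EDefinedBy r s abar σ xv φx := by
  classical
  choose i hl hu hi using ha
  have hcount : ∀ j ∈ Finset.range (r + s + 1), FOC.DefinableFun fun w : List A =>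
      ∑ p, if FOC.bit ((j : ℤ) - s) (a w p) = 1 then (1 : ℚ) else 0 := by
    intro j hj
    rw [Finset.mem_range] at hj
    have hk₁ : -(s : ℤ) ≤ (j : ℤ) - s := by omega
    have hk₂ : (j : ℤ) - s ≤ r := by omega
    obtain ⟨hc, hp, hs⟩ := hfree _ hk₁ hk₂
    have h := ((FOC.DefinableFun.const (A := A) 1).ite_zero
      (.of_isSentence hs (hω _ hk₁ hk₂))).add (.card_filter
        (R := fun w p => ∃ h : p < w.length + 1, FOC.bit ((j : ℤ) - s) (a w ⟨p, h⟩) = 1) hp hc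
        fun w p hp₁ hp₂ => (hφ _ hk₁ hk₂ w p hp₁ hp₂).trans
          ⟨fun h => ⟨by omega, h⟩, fun h => h.2⟩)
    convert h using 2 with w
    rw [Fin.sum_univ_succ]
    congr 1
    rw [Finset.card_filter, ← Finset.Ico_add_one_right_eq_Icc, Finset.sum_Ico_eq_sum_range,
      Finset.sum_range, Nat.cast_sum]
    refine Finset.sum_congr rfl fun p _ => ?_
    have hlt : 1 + (p : ℕ) < w.length + 1 := by omega
    have heq : (⟨1 + (p : ℕ), hlt⟩ : Fin (w.length + 1)) = p.succ := by ext; simp [add_comm]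
    simp [hlt, heq]
  have hS : FOC.DefinableFun fun w : List A => ((∑ p, i w p : ℤ) : ℚ) := by
    have h := (FOC.DefinableFun.sum (Finset.range (r + s + 1)) fun j hj =>
      (hcount j hj).const_mul (2 ^ j)).sub
        ((hcount (r + s) (by simp)).const_mul (2 ^ (r + s + 1)))
    convert h using 2 with w
    simp only [Finset.mul_sum]
    rw [Finset.sum_comm, ← Finset.sum_sub_distrib, Int.cast_sum]
    refine Finset.sum_congr rfl fun p _ => ?_
    have hval := congrArg (Int.cast : ℤ → ℚ) (FOC.twos_complement r s _ (hl w p) (hu w p))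
    have hbit : ∀ j : ℕ, (FOC.bit ((j : ℤ) - s) ((i w p : ℚ) / 2 ^ s) : ℚ) =
        if FOC.bit ((j : ℤ) - s) (a w p) = 1 then 1 else 0 := fun j => by
      rw [FOC.bit_div_two_pow_eq, hi]; push_cast; rfl
    rw [hval, ← hbit (r + s)]
    simp only [← hbit]
    push_cast
    rfl
  have hle : ∀ w : List A, -(2 : ℤ) ^ (r + s) * (w.length + 1 : ℕ) ≤ ∑ p, i w p := fun w => by
    have := Finset.card_nsmul_le_sum Finset.univ (i w) _ fun p _ => hl w p
    simpa [mul_comm] using this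
  have hlt : ∀ w : List A, ∑ p, i w p < 2 ^ (r + s) * (w.length + 1 : ℕ) := fun w => by
    have := Finset.sum_lt_sum_of_nonempty (s := Finset.univ) Finset.univ_nonempty
      fun p _ => hu w p
    simpa [mul_comm] using this
  refine ⟨fun w => ((∑ p, i w p : ℤ) : ℚ) / (2 ^ s * (w.length + 1 : ℕ)), fun w => ?_,
    fun w => ?_, FOC.exists_eDefinedBy r s _ hS hle hlt⟩
  · exact ⟨_, by simpa using hle w, hlt w, rfl⟩
  · have : ∑ p, a w p = ((∑ p, i w p : ℤ) : ℚ) / 2 ^ s := by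
      push_cast
      rw [Finset.sum_div]
      exact Finset.sum_congr rfl fun p _ => hi w p
    rw [this, div_div]
    push_cast
    rw [sub_self, abs_zero]
    positivity
end
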